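/- Suppose n ≡ 1 (mod 3) and k = (2n−2)/3 (so k is even). Then Δ_{n,k} = T_{(k+2)/2} − T_{k/2} in ⋀² M. -/

import Mathlib

open scoped Classical

noncomputable section

namespace Stmt

open ExteriorAlgebra

/-- `T n e r = Σ_{i=0}^{n-1} e_i ∧ e_{i+r}` in the exterior algebra of `M`. -/
def T (n : ℕ) {M : Type*} [AddCommGroup M] [Module ℤ M] (e : ZMod n → M)
    (r : ZMod n) : ExteriorAlgebra ℤ M :=
  ∑ i ∈ Finset.range n, ι ℤ (e i) * ι ℤ (e ((i : ZMod n) + r))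

/-- The coefficient `c_{I,J} = a⁺_{I,J} − a⁻_{I,J}`. -/
def cIJ (n k c : ℕ) (I J : ℕ) : ℤ :=
  (if ∃ j ∈ Finset.Icc 1 (c - 1),
      ((J : ZMod n) - (I : ZMod n)) = (j : ZMod n) * ((k : ZMod n) + 1) then 1 else 0)
  - (if ∃ j ∈ Finset.Icc 1 (c - 1),
      ((J : ZMod n) - (I : ZMod n)) = (j : ZMod n) * ((k : ZMod n) + 1) - 1 then 1 else 0)

/-- The classifying element `Δ_{n,k} = Σ_{1 ≤ I < J ≤ n−1} c_{I,J} · e_I ∧ e_J`. -/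
def Δ (n k c : ℕ) {M : Type*} [AddCommGroup M] [Module ℤ M] (e : ZMod n → M) :
    ExteriorAlgebra ℤ M :=
  ∑ I ∈ Finset.Icc 1 (n - 1), ∑ J ∈ Finset.Ioc I (n - 1),
    cIJ n k c I J • (ι ℤ (e (I : ZMod n)) * ι ℤ (e (J : ZMod n)))

/-- Sum over pairs `(i, i + d)` without wrap-around. -/
def A (n : ℕ) {M : Type*} [AddCommGroup M] [Module ℤ M] (e : ZMod n → M)
    (d : ℕ) : ExteriorAlgebra ℤ M :=
  ∑ i ∈ Finset.range (n - d), ι ℤ (e (i : ZMod n)) * ι ℤ (e ((i + d : ℕ) : ZMod n))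

theorem T_eq (n : ℕ) {M : Type*} [AddCommGroup M] [Module ℤ M] (e : ZMod n → M)
    (r : ℕ) (hr : r ≤ n) : T n e (r : ZMod n) = A n e r - A n e (n - r) := by
  obtain ⟨s, rfl⟩ := Nat.exists_eq_add_of_le' hr
  unfold T A
  rw [Finset.sum_range_add, sub_eq_add_neg, ← Finset.sum_neg_distrib]
  have h1 : s + r - r = s := by omega
  have h2 : s + r - (s + r - r) = r := by omega
  rw [h2, h1]
  congr 1
  · apply Finset.sum_congr rfl
    intro i _
    push_cast
    rfl
  · apply Finset.sum_congr rfl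
    intro i _
    have h3 : ((s + i : ℕ) : ZMod (s + r)) + (r : ZMod (s + r)) = (i : ZMod (s + r)) := by
      have : ((s + r : ℕ) : ZMod (s + r)) = 0 := ZMod.natCast_self _
      push_cast at this ⊢
      linear_combination this
    rw [h3, add_comm s i]
    exact eq_neg_of_add_eq_zero_left (ExteriorAlgebra.ι_add_mul_swap _ _)

theorem pair_sum (n : ℕ) {M : Type*} [AddCommGroup M] [Module ℤ M] (e : ZMod n → M)
    (he0 : e 0 = 0) (d : ℕ) (hd : 1 ≤ d) (hdn : d < n) :
    (∑ I ∈ Finset.Icc 1 (n - 1), ∑ J ∈ Finset.Ioc I (n - 1),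
      (if J = I + d then (1 : ℤ) else 0) • (ι ℤ (e (I : ZMod n)) * ι ℤ (e (J : ZMod n))))
      = A n e d := by
  have h : ∀ I ∈ Finset.Icc 1 (n - 1), (∑ J ∈ Finset.Ioc I (n - 1),
      (if J = I + d then (1 : ℤ) else 0) • (ι ℤ (e (I : ZMod n)) * ι ℤ (e (J : ZMod n))))
      = if I < n - d then ι ℤ (e (I : ZMod n)) * ι ℤ (e ((I + d : ℕ) : ZMod n)) else 0 := by
    intro I hI
    simp only [ite_smul, one_smul, zero_smul]
    rw [Finset.sum_ite_eq']
    apply if_congr _ rfl rfl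
    simp only [Finset.mem_Ioc]
    omega
  rw [Finset.sum_congr rfl h, ← Finset.sum_filter]
  unfold A
  apply Finset.sum_subset
  · intro x
    simp only [Finset.mem_filter, Finset.mem_range]
    exact fun h => h.2
  · intro x hx hx'
    simp only [Finset.mem_filter, Finset.mem_range, Finset.mem_Icc] at hx hx'
    have : x = 0 := by omega
    subst this
    simp [he0]

theorem diff_eq_iff (n I J d : ℕ) (a : ZMod n) (hIJ : I < J) (hJ : J < n) (hd : d < n)
    (ha : a = (d : ZMod n)) : ((J : ZMod n) - (I : ZMod n)) = a ↔ J = I + d := by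
  rw [ha, ← Nat.cast_sub hIJ.le, ZMod.natCast_eq_natCast_iff, Nat.ModEq,
    Nat.mod_eq_of_lt (by omega), Nat.mod_eq_of_lt hd]
  omega

theorem cIJ_eq (m I J : ℕ) (hm : 1 ≤ m) (hIJ : I < J) (hJ : J < 3 * m + 1) :
    cIJ (3 * m + 1) (2 * m) 3 I J =
      (if J = I + (m + 1) then (1 : ℤ) else 0) + (if J = I + (2 * m + 1) then (1 : ℤ) else 0)
      - (if J = I + m then (1 : ℤ) else 0) - (if J = I + 2 * m then (1 : ℤ) else 0) := by
  have h0 : ((3 * m + 1 : ℕ) : ZMod (3 * m + 1)) = 0 := ZMod.natCast_self _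
  have hI : Finset.Icc 1 (3 - 1) = {1, 2} := by decide
  unfold cIJ
  simp only [hI, Finset.mem_insert, Finset.mem_singleton, exists_eq_or_imp, exists_eq_left]
  push_cast at h0
  have e1 := diff_eq_iff _ I J (2 * m + 1) (((1 : ℕ) : ZMod (3 * m + 1)) * (((2 * m : ℕ) : ZMod (3 * m + 1)) + 1))
    hIJ hJ (by omega) (by push_cast; ring)
  have e2 := diff_eq_iff _ I J (m + 1) (((2 : ℕ) : ZMod (3 * m + 1)) * (((2 * m : ℕ) : ZMod (3 * m + 1)) + 1))
    hIJ hJ (by omega) (by push_cast; linear_combination h0)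
  have e3 := diff_eq_iff _ I J (2 * m) (((1 : ℕ) : ZMod (3 * m + 1)) * (((2 * m : ℕ) : ZMod (3 * m + 1)) + 1) - 1)
    hIJ hJ (by omega) (by push_cast; ring)
  have e4 := diff_eq_iff _ I J m (((2 : ℕ) : ZMod (3 * m + 1)) * (((2 * m : ℕ) : ZMod (3 * m + 1)) + 1) - 1)
    hIJ hJ (by omega) (by push_cast; linear_combination h0)
  simp only [e1, e2, e3, e4]
  split_ifs <;> first | rfl | omega

theorem stmt16 (n k c : ℕ) (hn : Odd n) (hn3 : 3 ≤ n)
    (hk1 : 1 ≤ k) (hk2 : k ≤ n - 2) (hgcd : Nat.gcd n (k * (k + 1)) = 1)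
    (hc1 : 1 ≤ c) (hc2 : c ≤ n - 1) (hc : (c * (k + 1)) % n = 1)
    (M : Type*) [AddCommGroup M] [Module ℤ M]
    (e : ZMod n → M) (he0 : e 0 = 0)
    (heInd : LinearIndependent ℤ (fun i : {x : ZMod n // x ≠ 0} => e i.val))
    (hn1 : n % 3 = 1) (hk : k = (2 * n - 2) / 3) :
    Δ n k c e = T n e (((k + 2) / 2 : ℕ) : ZMod n) - T n e ((k / 2 : ℕ) : ZMod n) := by
  obtain ⟨m, rfl⟩ : ∃ m, n = 3 * m + 1 := ⟨n / 3, by omega⟩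
  obtain rfl : k = 2 * m := by omega
  have hc3 : c = 3 := by
    have h1 : c * (2 * m + 1) ≡ 3 * (2 * m + 1) [MOD (3 * m + 1)] := by
      rw [Nat.ModEq, hc]
      have : 3 * (2 * m + 1) = 1 + (3 * m + 1) * 2 := by ring
      rw [this, Nat.add_mul_mod_self_left, Nat.mod_eq_of_lt (by omega)]
    have h2 := Nat.ModEq.cancel_right_of_coprime
      (Nat.Coprime.coprime_mul_left_right hgcd) h1
    have hm : 2 ≤ m := by
      rcases hn with ⟨t, ht⟩
      omega
    rw [Nat.ModEq, Nat.mod_eq_of_lt (by omega), Nat.mod_eq_of_lt (by omega)] at h2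
    exact h2
  subst hc3
  have hm : 1 ≤ m := by omega
  rw [show (2 * m + 2) / 2 = m + 1 by omega, show 2 * m / 2 = m by omega,
    T_eq _ _ _ (by omega), T_eq _ _ _ (by omega),
    show 3 * m + 1 - (m + 1) = 2 * m by omega, show 3 * m + 1 - m = 2 * m + 1 by omega,
    ← pair_sum _ e he0 (m + 1) (by omega) (by omega),
    ← pair_sum _ e he0 (2 * m) (by omega) (by omega),
    ← pair_sum _ e he0 m (by omega) (by omega),
    ← pair_sum _ e he0 (2 * m + 1) (by omega) (by omega)]
  unfold Δ
  simp only [← Finset.sum_sub_distrib]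
  apply Finset.sum_congr rfl
  intro I hI
  apply Finset.sum_congr rfl
  intro J hJ
  rw [Finset.mem_Ioc] at hJ
  rw [cIJ_eq m I J hm hJ.1 (by omega), ← sub_smul, ← sub_smul, ← sub_smul]
  congr 1
  ring

end Stmt
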